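/- arXiv:2002.01364 — 2 statements merged into one kernel-verified Lean document; each statement's English description precedes it below -/
import Mathlib

section
/- Let 𝒫 be the family of subsets of ℝ^d of the form ⋂_{v∈S} H_{v,≥−1} ∩ ⋂_{v'∈T} H_{v',≥0} for finite sets S, T ⊆ ℝ^d. Then for every P ∈ 𝒫: (i) the polar dual P* again belongs to 𝒫, and (ii) (P*)* = P. -/
open Set Pointwise

/-- The standard pairing `⟨v,u⟩ = ∑ i, v i * u i` on `ι → ℝ`. -/
noncomputable def dotProd {ι : Type*} [Fintype ι] (v u : ι → ℝ) : ℝ := ∑ i, v i * u i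

/-- The hyperplane `H_{v,h} = {u : ⟨v,u⟩ = h}`. -/
def hyperplane {ι : Type*} [Fintype ι] (v : ι → ℝ) (h : ℝ) : Set (ι → ℝ) :=
  {u | dotProd v u = h}

/-- The halfspace `H_{v,≥k} = {u : ⟨v,u⟩ ≥ k}`. -/
def halfspaceGe {ι : Type*} [Fintype ι] (v : ι → ℝ) (k : ℝ) : Set (ι → ℝ) :=
  {u | k ≤ dotProd v u}

/-- The polar dual `P* = {v : ⟨v,u⟩ ≥ -1 for all u ∈ P}`. -/
def polarDual {ι : Type*} [Fintype ι] (P : Set (ι → ℝ)) : Set (ι → ℝ) :=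
  {v | ∀ u ∈ P, -1 ≤ dotProd v u}

/-- Cast an integer vector to a real vector. -/
def castZ {ι : Type*} (w : ι → ℤ) : ι → ℝ := fun i => (w i : ℝ)

/-- A nonzero integer vector is primitive if the gcd of its coordinates is 1. -/
def IsPrimitiveVec {ι : Type*} [Fintype ι] (w : ι → ℤ) : Prop :=
  Finset.gcd Finset.univ w = 1

/-- The set of lattice points of `ι → ℝ`. -/
def latticePts (ι : Type*) : Set (ι → ℝ) := Set.range castZ

/-- A lattice polytope: convex hull of a finite nonempty set of lattice points. -/
def IsLatticePolytope {ι : Type*} [Fintype ι] (P : Set (ι → ℝ)) : Prop :=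
  ∃ S : Finset (ι → ℤ), S.Nonempty ∧ P = convexHull ℝ (castZ '' (S : Set (ι → ℤ)))

/-- A rational polytope: some positive integer dilate is a lattice polytope. -/
def IsRationalPolytope {ι : Type*} [Fintype ι] (P : Set (ι → ℝ)) : Prop :=
  ∃ n : ℕ, 0 < n ∧ IsLatticePolytope ((n : ℝ) • P)

/-- The cone of all nonnegative linear combinations of a finite family of vectors. -/
def coneOf {ι : Type*} [Fintype ι] {κ : Type*} [Fintype κ] (v : κ → ι → ℝ) :
    Set (ι → ℝ) :=
  {x | ∃ c : κ → ℝ, (∀ i, 0 ≤ c i) ∧ x = ∑ i, c i • v i}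

/-- The cone of all nonnegative linear combinations of elements of a set. -/
def coneHull {ι : Type*} [Fintype ι] (S : Set (ι → ℝ)) : Set (ι → ℝ) :=
  {x | ∃ (n : ℕ) (c : Fin n → ℝ) (u : Fin n → ι → ℝ),
    (∀ i, 0 ≤ c i) ∧ (∀ i, u i ∈ S) ∧ x = ∑ i, c i • u i}

/-- `v` is a minimal generating set for the cone it generates. -/
def IsMinimalGen {ι : Type*} [Fintype ι] {κ : Type*} [Fintype κ] [DecidableEq κ]
    (v : κ → ι → ℝ) : Prop :=
  ∀ i : κ, v i ∉ coneOf (fun j : {j : κ // j ≠ i} => v j.1)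

/-- The mutation condition for `(P,w,F)` with the family `{G_h}_{h ≤ 0}`:
`V(P) ∩ H_{w,h} ⊆ G_h + (−h)F ⊆ P ∩ H_{w,h}` for all `h ≤ 0`. -/
def MutCond {ι : Type*} [Fintype ι] (P : Set (ι → ℝ)) (w : ι → ℝ) (F : Set (ι → ℝ))
    (G : ℝ → Set (ι → ℝ)) : Prop :=
  ∀ h : ℝ, h ≤ 0 →
    (P.extremePoints ℝ) ∩ hyperplane w h ⊆ G h + (-h) • F ∧
    G h + (-h) • F ⊆ P ∩ hyperplane w h

/-- The combinatorial mutation `mut_w(P,F;{G_h})` of a rational polytope. -/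
def mutPoly {ι : Type*} [Fintype ι] (w : ι → ℝ) (F : Set (ι → ℝ)) (P : Set (ι → ℝ))
    (G : ℝ → Set (ι → ℝ)) : Set (ι → ℝ) :=
  convexHull ℝ ((⋃ h ∈ Set.Iic (0 : ℝ), G h) ∪ ⋃ h ∈ Set.Ici (0 : ℝ), (P ∩ hyperplane w h + h • F))

/-- The combinatorial mutation `mut_w(C,F;{G_h})` of a cone. -/
def mutCone {ι : Type*} [Fintype ι] (w : ι → ℝ) (F : Set (ι → ℝ)) (C : Set (ι → ℝ))
    (G : ℝ → Set (ι → ℝ)) : Set (ι → ℝ) :=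
  coneHull ((⋃ h ∈ Set.Iic (0 : ℝ), G h) ∪ ⋃ h ∈ Set.Ici (0 : ℝ), (C ∩ hyperplane w h + h • F))

/-- `C` is a rational polyhedral pointed cone: generated by finitely many primitive lattice
points forming a minimal generating set, and containing no line. -/
def IsRatPointedCone {ι : Type*} [Fintype ι] (C : Set (ι → ℝ)) : Prop :=
  ∃ (m : ℕ) (v : Fin m → ι → ℤ),
    (∀ i, IsPrimitiveVec (v i)) ∧
    IsMinimalGen (fun i => castZ (v i)) ∧
    C = coneOf (fun i => castZ (v i)) ∧
    C ∩ (-C) = {0}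

/-- The piecewise-linear map `φ_{w,F}(u) = u − u_min · w`, `u_min = min{⟨u,v⟩ : v ∈ F}`. -/
noncomputable def phiMut {ι : Type*} [Fintype ι] (w : ι → ℝ) (F : Set (ι → ℝ))
    (u : ι → ℝ) : ι → ℝ :=
  u - sInf ((fun v => dotProd u v) '' F) • w

/-- The recession cone of a set. -/
def recessionCone {ι : Type*} [Fintype ι] (A : Set (ι → ℝ)) : Set (ι → ℝ) :=
  {y | ∀ x ∈ A, ∀ t : ℝ, 0 ≤ t → x + t • y ∈ A}
/-- Membership in the family `𝒫` of finite intersections of halfspaces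
`H_{v,≥-1}` and `H_{v',≥0}`. -/
def MemCalP {ι : Type*} [Fintype ι] (P : Set (ι → ℝ)) : Prop :=
  ∃ S T : Finset (ι → ℝ),
    P = (⋂ v ∈ S, halfspaceGe v (-1)) ∩ ⋂ v' ∈ T, halfspaceGe v' 0

lemma hull_induct {E : Type*} [AddCommGroup E] [Module ℝ E] {s : Set E} (p : E → Prop)
    (hs : ∀ x ∈ s, p x) (h0 : p 0) (hadd : ∀ x y, p x → p y → p (x + y))
    (hsmul : ∀ (c : ℝ) x, 0 ≤ c → p x → p (c • x)) {x : E}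
    (hx : x ∈ PointedCone.hull ℝ s) : p x := by
  induction hx using Submodule.span_induction with
  | mem x h => exact hs x h
  | zero => exact h0
  | add x y _ _ h1 h2 => exact hadd x y h1 h2
  | smul a x _ h => exact hsmul a.1 x a.2 h

/-- One step of the double description method. -/
lemma cone_step {E : Type*} [AddCommGroup E] [Module ℝ E] (G : Set E) (hG : G.Finite)
    (f : E →ₗ[ℝ] ℝ) : ∃ G' : Set E, G'.Finite ∧
      ∀ x, x ∈ PointedCone.hull ℝ G' ↔ x ∈ PointedCone.hull ℝ G ∧ 0 ≤ f x := by
  set A : Set E := {g ∈ G | 0 ≤ f g} with hA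
  set B : Set E := {g ∈ G | f g < 0} with hB
  set D : Set E := Set.image2 (fun g h => f g • h - f h • g) A B with hD
  have hAf : A.Finite := hG.subset (fun x hx => hx.1)
  have hBf : B.Finite := hG.subset (fun x hx => hx.1)
  refine ⟨A ∪ D, hAf.union (hAf.image2 _ hBf), fun x => ⟨fun hx => ?_, fun ⟨hx, hfx⟩ => ?_⟩⟩
  · refine hull_induct (fun x => x ∈ PointedCone.hull ℝ G ∧ 0 ≤ f x) ?_ ?_ ?_ ?_ hx
    · rintro x (hx | ⟨g, hg, h, hh, rfl⟩)
      · exact ⟨PointedCone.subset_hull hx.1, hx.2⟩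
      · refine ⟨?_, ?_⟩
        · have e : f g • h - f h • g = f g • h + (-f h) • g := by module
          simp only [e]
          exact add_mem (PointedCone.smul_mem _ hg.2 (PointedCone.subset_hull hh.1))
            (PointedCone.smul_mem _ (by linarith [hh.2]) (PointedCone.subset_hull hg.1))
        · simp only [map_sub, map_smul, smul_eq_mul]
          linarith [mul_comm (f g) (f h)]
    · exact ⟨zero_mem _, by simp⟩
    · rintro x y ⟨h1, h2⟩ ⟨h3, h4⟩
      exact ⟨add_mem h1 h3, by rw [map_add]; positivity⟩
    · rintro c x hc ⟨h1, h2⟩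
      exact ⟨PointedCone.smul_mem _ hc h1, by rw [map_smul]; exact mul_nonneg hc h2⟩
  · have hdec : ∃ p ∈ PointedCone.hull ℝ A, ∃ n ∈ PointedCone.hull ℝ B, x = p + n := by
      refine hull_induct (fun x => ∃ p ∈ PointedCone.hull ℝ A, ∃ n ∈ PointedCone.hull ℝ B,
        x = p + n) ?_ ?_ ?_ ?_ hx
      · intro x hx
        rcases le_or_gt 0 (f x) with h | h
        · exact ⟨x, PointedCone.subset_hull ⟨hx, h⟩, 0, zero_mem _, by simp⟩
        · exact ⟨0, zero_mem _, x, PointedCone.subset_hull ⟨hx, h⟩, by simp⟩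
      · exact ⟨0, zero_mem _, 0, zero_mem _, by simp⟩
      · rintro _ _ ⟨p, hp, n, hn, rfl⟩ ⟨p', hp', n', hn', rfl⟩
        exact ⟨p + p', add_mem hp hp', n + n', add_mem hn hn', by abel⟩
      · rintro c _ hc ⟨p, hp, n, hn, rfl⟩
        exact ⟨c • p, PointedCone.smul_mem _ hc hp, c • n, PointedCone.smul_mem _ hc hn,
          by module⟩
    obtain ⟨p, hp, n, hn, rfl⟩ := hdec
    have hfp : 0 ≤ f p := by
      refine hull_induct (fun x => 0 ≤ f x) (fun x hx => hx.2) (by simp) ?_ ?_ hp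
      · intro x y h1 h2
        rw [map_add]; positivity
      · intro c x hc h
        rw [map_smul]; exact mul_nonneg hc h
    have hfn : f n ≤ 0 ∧ (f n = 0 → n = 0) := by
      refine hull_induct (fun x => f x ≤ 0 ∧ (f x = 0 → x = 0)) ?_ (by simp) ?_ ?_ hn
      · intro x hx
        exact ⟨hx.2.le, fun h => absurd h hx.2.ne⟩
      · rintro x y ⟨h1, h2⟩ ⟨h3, h4⟩
        rw [map_add]
        refine ⟨by linarith, fun h => ?_⟩
        rw [h2 (by linarith), h4 (by linarith), add_zero]
      · rintro c x hc ⟨h1, h2⟩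
        rw [map_smul, smul_eq_mul]
        refine ⟨mul_nonpos_of_nonneg_of_nonpos hc h1, fun h => ?_⟩
        rcases mul_eq_zero.1 h with h | h
        · rw [h, zero_smul]
        · rw [h2 h, smul_zero]
    have hpA : p ∈ PointedCone.hull ℝ (A ∪ D) := Submodule.span_mono subset_union_left hp
    have hcomb : f p • n - f n • p ∈ PointedCone.hull ℝ (A ∪ D) := by
      refine hull_induct (fun p => f p • n - f n • p ∈ PointedCone.hull ℝ (A ∪ D))
        ?_ (by simp) ?_ ?_ hp
      · intro g hg
        refine hull_induct (fun n => f g • n - f n • g ∈ PointedCone.hull ℝ (A ∪ D))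
          ?_ (by simp) ?_ ?_ hn
        · intro h hh
          exact PointedCone.subset_hull (Or.inr ⟨g, hg, h, hh, rfl⟩)
        · intro x y h1 h2
          convert add_mem h1 h2 using 1
          rw [map_add]; module
        · intro c x hc h1
          convert PointedCone.smul_mem _ hc h1 using 1
          rw [map_smul, smul_eq_mul]; module
      · intro x y h1 h2
        convert add_mem h1 h2 using 1
        rw [map_add]; module
      · intro c x hc h1
        convert PointedCone.smul_mem _ hc h1 using 1
        rw [map_smul, smul_eq_mul]; module
    rw [map_add] at hfx
    rcases hfp.eq_or_lt with h | h
    · have : n = 0 := hfn.2 (by linarith [hfn.1])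
      rw [this, add_zero]; exact hpA
    · have e : p + n = ((f p + f n) / f p) • p + (1 / f p) • (f p • n - f n • p) := by
        rw [add_div, div_self h.ne', smul_sub, smul_smul, smul_smul, one_div_mul_cancel h.ne']
        module
      rw [e]
      exact add_mem (PointedCone.smul_mem _ (by positivity) hpA)
        (PointedCone.smul_mem _ (by positivity) hcomb)

/-- Minkowski-Weyl: a polyhedral cone is finitely generated. -/
lemma cone_fg {E : Type*} [AddCommGroup E] [Module ℝ E] [Module.Finite ℝ E]
    {F : Set (E →ₗ[ℝ] ℝ)} (hF : F.Finite) : ∃ G : Set E, G.Finite ∧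
      ∀ x, x ∈ PointedCone.hull ℝ G ↔ ∀ f ∈ F, 0 ≤ f x := by
  induction F, hF using Set.Finite.induction_on with
  | empty =>
    obtain ⟨s, hs⟩ := (inferInstance : Module.Finite {c : ℝ // 0 ≤ c} E).fg_top
    exact ⟨s, s.finite_toSet, fun x => by simp [PointedCone.hull, hs]⟩
  | @insert f F _ _ ih =>
    obtain ⟨G, hG, h⟩ := ih
    obtain ⟨G', hG', h'⟩ := cone_step G hG f
    refine ⟨G', hG', fun x => ?_⟩
    rw [h', h, Set.forall_mem_insert, and_comm]

lemma dotProd_comm' {ι : Type*} [Fintype ι] (v u : ι → ℝ) : dotProd v u = dotProd u v := by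
  simp [dotProd, mul_comm]

lemma dotProd_add' {ι : Type*} [Fintype ι] (v u w : ι → ℝ) :
    dotProd v (u + w) = dotProd v u + dotProd v w := by
  simp [dotProd, mul_add, Finset.sum_add_distrib]

lemma dotProd_smul' {ι : Type*} [Fintype ι] (v u : ι → ℝ) (c : ℝ) :
    dotProd v (c • u) = c * dotProd v u := by
  simp only [dotProd, Finset.mul_sum, Pi.smul_apply, smul_eq_mul]
  exact Finset.sum_congr rfl fun i _ => by ring

/-- The functional `(u, t) ↦ ⟨v, u⟩ + a t`. -/
noncomputable def liftFun {ι : Type*} [Fintype ι] (v : ι → ℝ) (a : ℝ) :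
    ((ι → ℝ) × ℝ) →ₗ[ℝ] ℝ where
  toFun x := dotProd v x.1 + a * x.2
  map_add' x y := by simp only [Prod.fst_add, Prod.snd_add, dotProd_add']; ring
  map_smul' c x := by
    simp only [Prod.smul_fst, Prod.smul_snd, dotProd_smul', smul_eq_mul, RingHom.id_apply]; ring

lemma liftFun_apply {ι : Type*} [Fintype ι] (v : ι → ℝ) (a : ℝ) (x : (ι → ℝ) × ℝ) :
    liftFun v a x = dotProd v x.1 + a * x.2 := rfl

lemma nonneg_of_mul_ge {r : ℝ} (h : ∀ t : ℝ, 0 ≤ t → -1 ≤ t * r) : 0 ≤ r := by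
  by_contra hr
  push Not at hr
  have h1 := h (2 / (-r)) (by apply div_nonneg <;> linarith)
  have h2 : 2 / (-r) * r = -2 := by
    have : r ≠ 0 := hr.ne
    field_simp
  linarith

/-- For every `P ∈ 𝒫`, (i) `P* ∈ 𝒫` and (ii) `(P*)* = P`. -/
theorem stmt_1 {d : ℕ} (P : Set (Fin d → ℝ)) (hP : MemCalP P) :
    MemCalP (polarDual P) ∧ polarDual (polarDual P) = P := by
  classical
  obtain ⟨S, T, rfl⟩ := hP
  set P : Set (Fin d → ℝ) := (⋂ v ∈ S, halfspaceGe v (-1)) ∩ ⋂ v' ∈ T, halfspaceGe v' 0 with hPdef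
  have hmem : ∀ u, u ∈ P ↔ (∀ v ∈ S, -1 ≤ dotProd v u) ∧ ∀ v ∈ T, 0 ≤ dotProd v u := by
    intro u
    simp [hPdef, halfspaceGe]
  clear_value P
  constructor
  · have hF : (((fun v => liftFun v 1) '' (S : Set (Fin d → ℝ))) ∪
        ((fun v => liftFun v 0) '' (T : Set (Fin d → ℝ))) ∪ {liftFun 0 1}).Finite :=
      ((S.finite_toSet.image _).union (T.finite_toSet.image _)).union (Set.finite_singleton _)
    obtain ⟨G, hG, hGm⟩ := cone_fg hF
    have hGm' : ∀ x : (Fin d → ℝ) × ℝ, x ∈ PointedCone.hull ℝ G ↔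
        (∀ v ∈ S, 0 ≤ dotProd v x.1 + x.2) ∧ (∀ v ∈ T, 0 ≤ dotProd v x.1) ∧ 0 ≤ x.2 := by
      intro x
      rw [hGm]
      constructor
      · intro h
        refine ⟨fun v hv => ?_, fun v hv => ?_, ?_⟩
        · simpa [liftFun_apply] using h _ (Or.inl (Or.inl ⟨v, hv, rfl⟩))
        · simpa [liftFun_apply] using h _ (Or.inl (Or.inr ⟨v, hv, rfl⟩))
        · simpa [liftFun_apply, dotProd] using h _ (Or.inr rfl)
      · rintro ⟨h1, h2, h3⟩ f ((⟨v, hv, rfl⟩ | ⟨v, hv, rfl⟩) | rfl)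
        · simpa [liftFun_apply] using h1 v hv
        · simpa [liftFun_apply] using h2 v hv
        · simpa [liftFun_apply, dotProd] using h3
    refine ⟨(hG.toFinset.filter (fun x => 0 < x.2)).image (fun x => (x.2)⁻¹ • x.1),
      (hG.toFinset.filter (fun x => x.2 = 0)).image (fun x => x.1), ?_⟩
    ext v
    simp only [polarDual, halfspaceGe, mem_setOf_eq, mem_inter_iff, mem_iInter, Finset.mem_image,
      Finset.mem_filter, Set.Finite.mem_toFinset]
    constructor
    · intro h
      constructor
      · rintro _ ⟨x, ⟨hx, hx2⟩, rfl⟩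
        obtain ⟨h1, h2, h3⟩ := (hGm' x).1 (PointedCone.subset_hull hx)
        rw [dotProd_comm']
        refine h _ ((hmem _).2 ⟨fun w hw => ?_, fun w hw => ?_⟩)
        · rw [dotProd_smul']
          have := mul_nonneg (inv_nonneg.2 h3) (h1 w hw)
          rw [mul_add, inv_mul_cancel₀ hx2.ne'] at this
          linarith
        · rw [dotProd_smul']
          exact mul_nonneg (inv_nonneg.2 h3) (h2 w hw)
      · rintro _ ⟨x, ⟨hx, hx2⟩, rfl⟩
        obtain ⟨h1, h2, h3⟩ := (hGm' x).1 (PointedCone.subset_hull hx)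
        rw [dotProd_comm']
        refine nonneg_of_mul_ge fun t ht => ?_
        rw [← dotProd_smul']
        refine h _ ((hmem _).2 ⟨fun w hw => ?_, fun w hw => ?_⟩)
        · rw [dotProd_smul']
          have := h1 w hw
          rw [hx2, add_zero] at this
          linarith [mul_nonneg ht this]
        · rw [dotProd_smul']
          exact mul_nonneg ht (h2 w hw)
    · rintro ⟨hS, hT⟩ u hu
      have hu' : ((u, 1) : (Fin d → ℝ) × ℝ) ∈ PointedCone.hull ℝ G := by
        rw [hGm']
        obtain ⟨h1, h2⟩ := (hmem u).1 hu
        exact ⟨fun w hw => by linarith [h1 w hw], h2, zero_le_one⟩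
      have key : 0 ≤ liftFun v 1 (u, 1) := by
        refine hull_induct (fun x => 0 ≤ liftFun v 1 x) ?_ (by simp) ?_ ?_ hu'
        · intro x hx
          obtain ⟨-, -, h3⟩ := (hGm' x).1 (PointedCone.subset_hull hx)
          rw [liftFun_apply, one_mul]
          rcases h3.eq_or_lt with h | h
          · have := hT x.1 ⟨x, ⟨hx, h.symm⟩, rfl⟩
            rw [dotProd_comm'] at this
            linarith
          · have := hS _ ⟨x, ⟨hx, h⟩, rfl⟩
            rw [dotProd_comm', dotProd_smul'] at this
            have h5 := mul_le_mul_of_nonneg_left this h.le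
            rw [← mul_assoc, mul_inv_cancel₀ h.ne'] at h5
            linarith
        · intro x y h1 h2
          rw [map_add]; positivity
        · intro c x hc h
          rw [map_smul]; exact mul_nonneg hc h
      rw [liftFun_apply] at key
      simp only at key
      linarith
  · ext x
    constructor
    · intro hx
      refine (hmem x).2 ⟨fun v hv => ?_, fun v hv => ?_⟩
      · rw [dotProd_comm']
        exact hx v fun u hu => ((hmem u).1 hu).1 v hv
      · rw [dotProd_comm']
        refine nonneg_of_mul_ge fun t ht => ?_
        rw [← dotProd_smul']
        refine hx _ fun u hu => ?_
        rw [dotProd_comm', dotProd_smul', dotProd_comm']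
        linarith [mul_nonneg ht (((hmem u).1 hu).2 v hv)]
    · intro hx v hv
      rw [dotProd_comm']
      exact hv x hx
end

section
/- Let P ⊆ ℝ^d be a rational polytope, w ∈ ℤ^d primitive, F ⊆ w^⊥ a lattice polytope, and suppose {G_h}_{h≤0} satisfies the mutation condition for (P,w,F). Let u ∈ w^⊥ ∩ ℤ^d. Then the family {G_h + hu}_{h≤0} satisfies the mutation condition for (P,w,F+u), and mut_w(P,F+u;{G_h+hu}) = T(mut_w(P,F;{G_h})), where T : ℝ^d → ℝ^d is the unimodular linear map T(x) := x + ⟨w,x⟩·u (which maps ℤ^d bijectively onto ℤ^d). In particular mut_w(P,F+u;{G_h+hu}) and mut_w(P,F;{G_h}) are unimodularly equivalent. -/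
open Set Pointwise

theorem dotProd_add6 {d : ℕ} (w x y : Fin d → ℝ) :
    dotProd w (x + y) = dotProd w x + dotProd w y := by
  simp [dotProd, mul_add, Finset.sum_add_distrib]

theorem dotProd_smul6 {d : ℕ} (w : Fin d → ℝ) (c : ℝ) (x : Fin d → ℝ) :
    dotProd w (c • x) = c * dotProd w x := by
  simp only [dotProd, Pi.smul_apply, smul_eq_mul, Finset.mul_sum]
  exact Finset.sum_congr rfl fun i _ => by ring

theorem linear6 {d : ℕ} (w u : Fin d → ℝ) :
    IsLinearMap ℝ (fun x : Fin d → ℝ => x + dotProd w x • u) where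
  map_add x y := by
    simp only [dotProd_add6]; module
  map_smul c x := by
    simp only [dotProd_smul6]; module

theorem lattice6 {d : ℕ} (w u x : Fin d → ℤ) (s : ℤ) :
    castZ x + ((s : ℝ) * dotProd (castZ w) (castZ x)) • castZ u ∈ latticePts (Fin d) := by
  refine ⟨x + (s * ∑ i, w i * x i) • u, ?_⟩
  ext i
  simp [castZ, dotProd]

theorem sets6 {d : ℕ} (A F : Set (Fin d → ℝ)) (u : Fin d → ℝ) (h : ℝ) :
    (A + {h • u}) + (-h) • (F + {u}) = A + (-h) • F := by
  rw [smul_add, smul_set_singleton, add_add_add_comm, singleton_add_singleton]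
  simp

theorem image6 {d : ℕ} (w u : Fin d → ℝ) (A : Set (Fin d → ℝ)) (h : ℝ)
    (hA : ∀ x ∈ A, dotProd w x = h) :
    (fun x => x + dotProd w x • u) '' A = A + {h • u} := by
  rw [add_singleton]
  exact image_congr fun x hx => by rw [hA x hx]

/-- Translating the factor `F` by a lattice point `u ∈ w^⊥ ∩ ℤ^d` changes
the mutation by the unimodular linear map `T(x) = x + ⟨w,x⟩·u`. -/
theorem stmt_6 {d : ℕ} (P : Set (Fin d → ℝ)) (hP : IsRationalPolytope P)
    (w : Fin d → ℤ) (hw : IsPrimitiveVec w)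
    (F : Set (Fin d → ℝ)) (hF : IsLatticePolytope F) (hFw : F ⊆ hyperplane (castZ w) 0)
    (G : ℝ → Set (Fin d → ℝ))
    (hGrat : ∀ h : ℝ, h ≤ 0 → G h = ∅ ∨ IsRationalPolytope (G h))
    (hG : MutCond P (castZ w) F G)
    (u : Fin d → ℤ) (hu : castZ u ∈ hyperplane (castZ w) 0) :
    MutCond P (castZ w) (F + {castZ u}) (fun h => G h + {h • castZ u}) ∧
    mutPoly (castZ w) (F + {castZ u}) P (fun h => G h + {h • castZ u}) =
      (fun x => x + dotProd (castZ w) x • castZ u) '' mutPoly (castZ w) F P G ∧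
    IsLinearMap ℝ (fun x : Fin d → ℝ => x + dotProd (castZ w) x • castZ u) ∧
    Set.BijOn (fun x : Fin d → ℝ => x + dotProd (castZ w) x • castZ u)
      (latticePts (Fin d)) (latticePts (Fin d)) := by
  have hu0 : dotProd (castZ w) (castZ u) = 0 := hu
  have hFne : F.Nonempty := by
    obtain ⟨S, hS, rfl⟩ := hF
    rw [convexHull_nonempty_iff]
    exact (Finset.coe_nonempty.mpr hS).image _
  have hGh : ∀ h : ℝ, h ≤ 0 → ∀ x ∈ G h, dotProd (castZ w) x = h := by
    intro h hh x hx
    obtain ⟨f, hf⟩ := hFne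
    have h1 := ((hG h hh).2 (add_mem_add hx (smul_mem_smul_set hf))).2
    have h2 : dotProd (castZ w) f = 0 := hFw hf
    have h3 : dotProd (castZ w) (x + (-h) • f) = h := h1
    rw [dotProd_add6, dotProd_smul6, h2] at h3
    linarith
  refine ⟨?_, ?_, linear6 _ _, ?_, ?_, ?_⟩
  · intro h hh
    simp only [sets6]
    exact hG h hh
  · unfold mutPoly
    rw [(linear6 (castZ w) (castZ u)).image_convexHull, image_union, image_iUnion₂, image_iUnion₂]
    congr 2
    · exact iUnion₂_congr fun h hh => (image6 _ _ _ _ (hGh h hh)).symm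
    · refine iUnion₂_congr fun h hh => ?_
      rw [image6 _ _ _ h, smul_add, smul_set_singleton, add_assoc]
      rintro _ ⟨p, hp, _, ⟨f, hf, rfl⟩, rfl⟩
      have h1 : dotProd (castZ w) p = h := hp.2
      have h2 : dotProd (castZ w) f = 0 := hFw hf
      simp only [dotProd_add6, dotProd_smul6, h1, h2]
      simp
  · rintro _ ⟨x, rfl⟩
    simpa using lattice6 w u x 1
  · intro x _ y _ hxy
    have h1 : x + dotProd (castZ w) x • castZ u = y + dotProd (castZ w) y • castZ u := hxy
    have h2 := congrArg (dotProd (castZ w)) h1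
    simp only [dotProd_add6, dotProd_smul6, hu0, mul_zero, add_zero] at h2
    rw [h2] at h1
    exact add_right_cancel h1
  · rintro _ ⟨x, rfl⟩
    refine ⟨_, lattice6 w u x (-1), ?_⟩
    simp only [dotProd_add6, dotProd_smul6, hu0]
    push_cast
    module
end
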